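/- There is an absolute constant C > 0 such that for every finite set S of rational primes and every real s > 1, the derivative of the function s ↦ ζ^S(s) = ∏_{p ∉ S}(1 − p^{−s})^{−1} satisfies |(ζ^S)'(s)| ≤ C · s · ζ(s)/(s − 1). -/

import Mathlib

open Filter Topology

/-- The completely multiplicative function `n ↦ n^{-t}` restricted to `n` coprime to `P`. -/
noncomputable def cpHom (P : ℕ) (t : ℝ) (ht : t ≠ 0) : ℕ →*₀ ℝ where
  toFun n := if n.Coprime P then (n : ℝ) ^ (-t) else 0
  map_zero' := by simp [Real.zero_rpow (neg_ne_zero.mpr ht)]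
  map_one' := by simp
  map_mul' m n := by
    have h : ((m * n : ℕ) : ℝ) ^ (-t) = (m : ℝ) ^ (-t) * (n : ℝ) ^ (-t) := by
      rw [Nat.cast_mul, Real.mul_rpow (Nat.cast_nonneg m) (Nat.cast_nonneg n)]
    simp only [Nat.coprime_mul_iff_left, h]
    split_ifs <;> first | rfl | tauto | simp

lemma cpHom_apply (P : ℕ) (t : ℝ) (ht : t ≠ 0) (n : ℕ) :
    cpHom P t ht n = if n.Coprime P then (n : ℝ) ^ (-t) else 0 := rfl

lemma summable_neg {t : ℝ} (ht : 1 < t) : Summable (fun n : ℕ => (n : ℝ) ^ (-t)) :=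
  Real.summable_nat_rpow.mpr (by linarith)

lemma summable_cp (P : ℕ) {t : ℝ} (ht : 1 < t) :
    Summable (fun n : ℕ => if n.Coprime P then (n : ℝ) ^ (-t) else 0) := by
  refine Summable.of_nonneg_of_le (fun n => ?_) (fun n => ?_) (summable_neg ht)
  · split_ifs <;> positivity
  · split_ifs
    · exact le_rfl
    · positivity

lemma partial_eq (S : Finset ℕ) (hS : ∀ p ∈ S, p.Prime) {t : ℝ} (ht : 1 < t) :
    ∏' p : {p : Nat.Primes // (p : ℕ) ∉ S}, (1 - (((p : Nat.Primes) : ℕ) : ℝ) ^ (-t))⁻¹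
      = ∑' n : ℕ, if n.Coprime (∏ p ∈ S, p) then (n : ℝ) ^ (-t) else 0 := by
  have ht0 : t ≠ 0 := by linarith
  have h1 := EulerProduct.eulerProduct_completely_multiplicative_tprod
    (f := cpHom (∏ p ∈ S, p) t ht0) (by
      have := (summable_cp (∏ p ∈ S, p) ht).norm
      exact this)
  have h2 := tprod_subtype {p : Nat.Primes | (p : ℕ) ∉ S}
    (fun p : Nat.Primes => (1 - ((p : ℕ) : ℝ) ^ (-t))⁻¹)
  refine Eq.trans h2 (Eq.trans ?_ h1)
  refine tprod_congr fun p => ?_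
  rw [cpHom_apply]
  by_cases hp : (p : ℕ) ∈ S
  · have : ¬ (p : ℕ).Coprime (∏ p ∈ S, p) := by
      rw [Nat.Prime.coprime_iff_not_dvd p.2, not_not]
      exact Finset.dvd_prod_of_mem _ hp
    rw [if_neg this, Set.mulIndicator_of_notMem (by simpa using hp)]
    simp
  · have : (p : ℕ).Coprime (∏ p ∈ S, p) := by
      rw [Nat.coprime_prod_right_iff]
      intro q hq
      rw [Nat.coprime_primes p.2 (hS q hq)]
      rintro rfl
      exact hp hq
    rw [if_pos this, Set.mulIndicator_of_mem (by simpa using hp)]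

lemma rpow_diff {x a b : ℝ} (hx : 0 < x) :
    x ^ (-a) - x ^ (-b) ≤ x ^ (-a) * ((b - a) * Real.log x) := by
  have h : x ^ (-b) = x ^ (-a) * Real.exp (-((b - a) * Real.log x)) := by
    rw [Real.rpow_def_of_pos hx, Real.rpow_def_of_pos hx, ← Real.exp_add]
    congr 1
    ring
  have h2 := Real.add_one_le_exp (-((b - a) * Real.log x))
  have h3 : 0 ≤ x ^ (-a) := by positivity
  rw [h]
  nlinarith

lemma term_le {e r a b : ℝ} (he : 0 < e) (hr : r ≤ a - e) (hab : a ≤ b) (n : ℕ) (hn : n ≠ 0) :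
    |(n : ℝ) ^ (-a) - (n : ℝ) ^ (-b)| ≤ (b - a) * (1 / e * (n : ℝ) ^ (-r)) := by
  have hn1 : (1 : ℝ) ≤ n := by exact_mod_cast Nat.one_le_iff_ne_zero.mpr hn
  have hn0 : (0 : ℝ) < n := by linarith
  rw [abs_of_nonneg (sub_nonneg.mpr (Real.rpow_le_rpow_of_exponent_le hn1 (by linarith)))]
  refine (rpow_diff hn0).trans ?_
  have h1 : Real.log n ≤ (n : ℝ) ^ e / e := Real.log_le_rpow_div hn0.le he
  have h2 : (n : ℝ) ^ (-a) * (n : ℝ) ^ e ≤ (n : ℝ) ^ (-r) := by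
    rw [← Real.rpow_add hn0]
    exact Real.rpow_le_rpow_of_exponent_le hn1 (by linarith)
  calc (n : ℝ) ^ (-a) * ((b - a) * Real.log n)
      ≤ (n : ℝ) ^ (-a) * ((b - a) * ((n : ℝ) ^ e / e)) := by
        have : 0 ≤ b - a := by linarith
        gcongr
    _ = (b - a) * (1 / e * ((n : ℝ) ^ (-a) * (n : ℝ) ^ e)) := by ring
    _ ≤ _ := by
        have : 0 ≤ b - a := by linarith
        gcongr

lemma tsum_shift {t : ℝ} (ht : 1 < t) :
    ∑' n : ℕ, (n : ℝ) ^ (-t) = ∑' n : ℕ, ((n : ℝ) + 1) ^ (-t) := by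
  rw [(summable_neg ht).tsum_eq_zero_add]
  simp [Real.zero_rpow (show -t ≠ 0 by linarith)]

lemma summable_shift {t : ℝ} (ht : 1 < t) :
    Summable (fun n : ℕ => ((n : ℝ) + 1) ^ (-t)) := by
  exact_mod_cast (summable_nat_add_iff 1).mpr (summable_neg ht)

lemma zeta_upper {t : ℝ} (ht : 1 < t) :
    ∑' n : ℕ, ((n : ℝ) + 1) ^ (-t) ≤ t / (t - 1) := by
  have h := ZetaAsymptotics.termTSum_of_lt ht
  have h0 : 0 ≤ ZetaAsymptotics.termTSum t :=
    tsum_nonneg fun n => ZetaAsymptotics.term_nonneg _ _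
  have he : ∑' n : ℕ, ((n : ℝ) + 1) ^ (-t) = ∑' n : ℕ, 1 / ((n : ℝ) + 1) ^ t :=
    tsum_congr fun n => by rw [Real.rpow_neg (by positivity), one_div]
  rw [he]
  have h1 : 1 / t * ∑' n : ℕ, 1 / ((n : ℝ) + 1) ^ t ≤ 1 / (t - 1) := by linarith
  have h2 := mul_le_mul_of_nonneg_left h1 (show 0 ≤ t by linarith)
  rw [← mul_assoc, mul_one_div_cancel (by linarith), one_mul] at h2
  simpa [div_eq_mul_inv] using h2

lemma zeta_lower {t : ℝ} (ht : 1 < t) :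
    1 / (t - 1) ≤ ∑' n : ℕ, ((n : ℝ) + 1) ^ (-t) := by
  have hd : 0 < t - 1 := by linarith
  have key : ∀ N : ℕ, 1 - ((N : ℝ) + 1) ^ (-(t - 1)) ≤
      (t - 1) * ∑ n ∈ Finset.range N, ((n : ℝ) + 1) ^ (-t) := by
    intro N
    induction N with
    | zero => simp
    | succ N ih =>
      rw [Finset.sum_range_succ, mul_add]
      push_cast
      have ha : (0 : ℝ) < (N : ℝ) + 1 := by positivity
      have hstep : ((N : ℝ) + 1) ^ (-(t - 1)) - ((N : ℝ) + 1 + 1) ^ (-(t - 1))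
          ≤ (t - 1) * ((N : ℝ) + 1) ^ (-t) := by
        set a : ℝ := (N : ℝ) + 1 with hadef
        have hq : 0 < 1 + 1 / a := by positivity
        have h1 := rpow_diff (x := 1 + 1 / a) (a := 0) (b := t - 1) hq
        have h2 : Real.log (1 + 1 / a) ≤ 1 / a := by
          have := Real.log_le_sub_one_of_pos hq
          linarith
        have h3 : (a + 1) ^ (-(t - 1)) = a ^ (-(t - 1)) * (1 + 1 / a) ^ (-(t - 1)) := by
          rw [← Real.mul_rpow ha.le hq.le]
          congr 1
          field_simp
        have h4 : a ^ (-t) = a ^ (-(t - 1)) * (1 / a) := by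
          rw [show -t = -(t - 1) - 1 by ring, Real.rpow_sub_one ha.ne']
          ring
        simp only [neg_zero, Real.rpow_zero, sub_zero, one_mul] at h1
        have h5 : 1 - (1 + 1 / a) ^ (-(t - 1)) ≤ (t - 1) * (1 / a) :=
          h1.trans (mul_le_mul_of_nonneg_left h2 hd.le)
        have h6 := mul_le_mul_of_nonneg_left h5 (show 0 ≤ a ^ (-(t - 1)) by positivity)
        rw [h3, h4]
        linarith
      linarith
  have hlim : Tendsto (fun N : ℕ => 1 - ((N : ℝ) + 1) ^ (-(t - 1))) atTop (𝓝 (1 - 0)) := by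
    refine tendsto_const_nhds.sub ((tendsto_rpow_neg_atTop hd).comp ?_)
    exact tendsto_atTop_add_const_right _ _ tendsto_natCast_atTop_atTop
  have hfin : 1 - 0 ≤ (t - 1) * ∑' n : ℕ, ((n : ℝ) + 1) ^ (-t) := by
    refine le_of_tendsto hlim (Eventually.of_forall fun N => (key N).trans ?_)
    refine mul_le_mul_of_nonneg_left ?_ hd.le
    exact (summable_shift ht).sum_le_tsum _ (fun n _ => by positivity)
  rw [div_le_iff₀ hd]
  linarith

lemma zeta_one_le {t : ℝ} (ht : 1 < t) :
    1 ≤ ∑' n : ℕ, ((n : ℝ) + 1) ^ (-t) := by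
  have := (summable_shift ht).sum_le_tsum (Finset.range 1) (fun n _ => by positivity)
  simpa using this

/-- Lemma 3.4 (second estimate): there is an absolute constant `C > 0` such that for
every finite set `S` of rational primes and every real `s > 1`, the derivative of
`s ↦ ζ^S(s) = ∏_{p ∉ S} (1 - p^{-s})⁻¹` satisfies
`|(ζ^S)'(s)| ≤ C · s · ζ(s) / (s - 1)`, where `ζ(s) = ∑_{n ≥ 1} n^{-s}`. -/
theorem deriv_partial_euler_product_bound :
    ∃ C : ℝ, 0 < C ∧ ∀ S : Finset ℕ, (∀ p ∈ S, p.Prime) → ∀ s : ℝ, 1 < s →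
      |deriv (fun t : ℝ =>
          ∏' p : {p : Nat.Primes // (p : ℕ) ∉ S}, (1 - (((p : Nat.Primes) : ℕ) : ℝ) ^ (-t))⁻¹) s|
        ≤ C * s * (∑' n : ℕ, ((n : ℝ) + 1) ^ (-s)) / (s - 1) := by
  refine ⟨12, by norm_num, fun S hS s hs => ?_⟩
  set Z := ∑' n : ℕ, ((n : ℝ) + 1) ^ (-s) with hZ
  have hd : 0 < s - 1 := by linarith
  have hr : 1 < (s + 1) / 2 := by linarith
  have hZ1 : 1 ≤ Z := zeta_one_le hs
  have hZ2 : 1 / (s - 1) ≤ Z := zeta_lower hs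
  set W := ∑' n : ℕ, ((n : ℝ) + 1) ^ (-((s + 1) / 2)) with hW
  have hWZ : W ≤ 3 * Z := by
    have h := zeta_upper hr
    have h' : (s + 1) / 2 / ((s + 1) / 2 - 1) = 1 + 2 * (1 / (s - 1)) := by
      have : (s + 1) / 2 - 1 = (s - 1) / 2 := by ring
      rw [this]
      field_simp
      ring
    rw [h'] at h
    linarith
  have hW0 : 0 ≤ W := tsum_nonneg fun n => by positivity
  have he : 0 < (s - 1) / 4 := by linarith
  have main : ‖deriv (fun t : ℝ =>
      ∏' p : {p : Nat.Primes // (p : ℕ) ∉ S}, (1 - (((p : Nat.Primes) : ℕ) : ℝ) ^ (-t))⁻¹) s‖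
      ≤ 1 / ((s - 1) / 4) * W := by
    refine norm_deriv_le_of_lip' (by positivity) ?_
    filter_upwards [lt_mem_nhds (show s - (s - 1) / 4 < s by linarith)] with t ht
    have ht1 : 1 < t := by linarith
    rw [partial_eq S hS ht1, partial_eq S hS hs,
      ← (summable_cp _ ht1).tsum_sub (summable_cp _ hs), hW, ← tsum_shift hr, mul_comm,
      ← tsum_mul_left, ← tsum_mul_left]
    refine tsum_of_norm_bounded
      (((summable_neg hr).mul_left _).mul_left _).hasSum fun n => ?_
    rcases eq_or_ne n 0 with rfl | hn
    · simp [Real.zero_rpow (show -t ≠ 0 by linarith), Real.zero_rpow (show -s ≠ 0 by linarith)]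
      positivity
    · split_ifs
      · rw [Real.norm_eq_abs, Real.norm_eq_abs]
        rcases le_total t s with h | h
        · rw [abs_of_nonpos (sub_nonpos.mpr h), neg_sub]
          exact term_le he (by linarith) h n hn
        · rw [abs_of_nonneg (sub_nonneg.mpr h), abs_sub_comm]
          exact term_le he (by linarith) h n hn
      · rw [sub_self, norm_zero]
        positivity
  rw [Real.norm_eq_abs] at main
  refine main.trans ?_
  rw [one_div_div, div_mul_eq_mul_div]
  refine div_le_div_of_nonneg_right ?_ hd.le
  nlinarith
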